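/- Let D be a probability distribution over X×Y, h ∈ H a fixed hypothesis, P a prior distribution over H, and δ ∈ (0,1]. With probability at least 1−δ over the draw of an i.i.d. sample S ~ D^m, simultaneously for all distributions Q over H: kl( ĉ_S^Q(h) || c_D^Q(h) ) ≤ (1/m_{(h,1)}) [ KL(Q||P) + ln(2√m/δ) ], where ĉ_S^Q(h) = E_{h'~Q} L̂_{S_{(h,1)}}(h'), S_{(h,1)} = {(x,y)∈S : ℓ(h(x),y)=1}, and m_{(h,1)} = |S_{(h,1)}|. -/

import Mathlib

/-!
STATEMENT 3 (Conditional PAC-Bayes bound, incorrect-prediction part).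
With probability at least `1−δ` over `S ∼ D^m`, simultaneously for all
posteriors `Q` over `H`:
`kl(ĉ_S^Q(h) ‖ c_D^Q(h)) ≤ (KL(Q‖P) + ln(2√m/δ)) / m_{(h,1)}`.
-/

open MeasureTheory ProbabilityTheory
open scoped ENNReal Classical

/-- Binary KL divergence `kl(q,p) = q ln(q/p) + (1−q) ln((1−q)/(1−p))`. -/
noncomputable def klBin (q p : ℝ) : ℝ :=
  q * Real.log (q / p) + (1 - q) * Real.log ((1 - q) / (1 - p))

/-- Kullback–Leibler divergence `KL(Q‖P)` between measures on `H`
(`∞` when `Q` is not absolutely continuous w.r.t. `P` or the logarithm of the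
density is not integrable). -/
noncomputable def klDivM {H : Type*} [MeasurableSpace H] (Q P : Measure H) : ℝ≥0∞ :=
  if Q ≪ P ∧ Integrable (fun h' => Real.log (Q.rnDeriv P h').toReal) Q then
    ENNReal.ofReal (∫ h', Real.log (Q.rnDeriv P h').toReal ∂Q)
  else ∞

section AbelSum

open Finset

theorem factorial_sum_sq_le_of_lt_sixty : ∀ n < 60, 1 ≤ n →
    (∑ k ∈ range (n + 1),
      n.factorial / (k.factorial * (n - k).factorial) * k ^ k * (n - k) ^ (n - k)) ^ 2 ≤
      4 * n * (n ^ n) ^ 2 := by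
  decide +kernel

theorem abelSum_sq_le_of_lt_sixty {n : ℕ} (hn : n < 60) (hn1 : 1 ≤ n) :
    (∑ k ∈ range (n + 1), n.choose k * k ^ k * (n - k) ^ (n - k)) ^ 2 ≤ 4 * n * (n ^ n) ^ 2 := by
  rw [sum_congr rfl fun k hk => by
    rw [Nat.choose_eq_factorial_div_factorial (mem_range_succ_iff.1 hk)]]
  exact factorial_sum_sq_le_of_lt_sixty n hn hn1

theorem sum_Ico_inv_sqrt_le (n : ℕ) : ∑ k ∈ Ico 1 n, (√(k : ℝ))⁻¹ ≤ 2 * √(n : ℝ) := by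
  have key : ∑ k ∈ Ico 1 (n + 1), (√(k : ℝ))⁻¹ ≤ 2 * √(n : ℝ) := by
    induction n with
    | zero => simp
    | succ n ih =>
      rw [sum_Ico_succ_top (by omega)]
      have h0 : 0 < √((n + 1 : ℕ) : ℝ) := Real.sqrt_pos.2 (by positivity)
      have h1 : √((n + 1 : ℕ) : ℝ) * √((n + 1 : ℕ) : ℝ) = n + 1 := by
        rw [Real.mul_self_sqrt (by positivity)]
        push_cast
        rfl
      have h2 : √(n : ℝ) * √(n : ℝ) = n := Real.mul_self_sqrt (by positivity)
      have h3 : (√((n + 1 : ℕ) : ℝ))⁻¹ ≤ 2 * √((n + 1 : ℕ) : ℝ) - 2 * √(n : ℝ) := by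
        rw [inv_le_iff_one_le_mul₀ h0]
        nlinarith [sq_nonneg (√((n + 1 : ℕ) : ℝ) - √(n : ℝ))]
      linarith
  refine le_trans (sum_le_sum_of_subset_of_nonneg (Ico_subset_Ico_right n.le_succ) ?_) key
  intros
  positivity

theorem pow_self_le_stirling {k : ℕ} (hk : 0 < k) :
    (k : ℝ) ^ k ≤ k.factorial * Real.exp k / (√(2 * Real.pi) * √k) := by
  have h := Stirling.le_factorial_stirling k
  have hk' : (0 : ℝ) < k := by exact_mod_cast hk
  rw [le_div_iff₀ (by positivity)]
  rw [Real.sqrt_mul (by positivity), div_pow, ← Real.exp_nat_mul, mul_one, mul_div_assoc',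
    div_le_iff₀ (Real.exp_pos _)] at h
  linarith

theorem factorial_le_stirling {n : ℕ} (hn : 0 < n) :
    (n.factorial : ℝ) * Real.exp n ≤ Real.exp 1 * √n * (n : ℝ) ^ n := by
  obtain ⟨k, rfl⟩ := Nat.exists_eq_succ_of_ne_zero hn.ne'
  have h := Stirling.stirlingSeq'_antitone (Nat.zero_le k)
  simp only [Function.comp_apply, Nat.succ_eq_add_one, zero_add, Stirling.stirlingSeq_one] at h
  rw [Stirling.stirlingSeq, div_le_div_iff₀ (by positivity) (by positivity), div_pow,
    ← Real.exp_nat_mul, mul_one, Real.sqrt_mul (by positivity)] at h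
  have h2 : 0 < √(2 : ℝ) := by positivity
  have h3 : ((k + 1).factorial : ℝ) ≤
      Real.exp 1 * √((k + 1 : ℕ) : ℝ) * (((k + 1 : ℕ) : ℝ) ^ (k + 1) / Real.exp ((k + 1 : ℕ) : ℝ)) := by
    refine le_of_mul_le_mul_right ?_ h2
    linarith
  rwa [mul_div_assoc', le_div_iff₀ (Real.exp_pos _)] at h3

theorem choose_mul_pow_self_le {n k : ℕ} (hk : 0 < k) (hkn : k < n) :
    (n.choose k : ℝ) * (k : ℝ) ^ k * ((n - k : ℕ) : ℝ) ^ (n - k) ≤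
      Real.exp 1 / (2 * Real.pi) * ((√(k : ℝ))⁻¹ + (√((n - k : ℕ) : ℝ))⁻¹) * (n : ℝ) ^ n := by
  obtain ⟨l, rfl⟩ := Nat.exists_eq_add_of_lt hkn
  set j := l + 1 with hj
  have hkl : k + l + 1 - k = j := by omega
  have hkl' : k + l + 1 = k + j := by omega
  rw [hkl]
  rw [hkl']
  have hj0 : 0 < j := by omega
  clear_value j
  have e1 := pow_self_le_stirling hk
  have e2 := pow_self_le_stirling hj0
  have e3 := factorial_le_stirling (show 0 < k + j by omega)
  have e4 : ((k + j).choose k : ℝ) * k.factorial * j.factorial = (k + j).factorial := by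
    rw [Nat.choose_symm_add]
    exact_mod_cast Nat.add_choose_mul_factorial_mul_factorial k j
  have hk' : 0 < √(k : ℝ) := Real.sqrt_pos.2 (by exact_mod_cast hk)
  have hj' : 0 < √(j : ℝ) := Real.sqrt_pos.2 (by exact_mod_cast hj0)
  have hs : √((k + j : ℕ) : ℝ) ≤ √(k : ℝ) + √(j : ℝ) := by
    push_cast
    refine Real.sqrt_le_iff.2 ⟨by positivity, ?_⟩
    nlinarith [Real.sq_sqrt (Nat.cast_nonneg (α := ℝ) k), Real.sq_sqrt (Nat.cast_nonneg (α := ℝ) j)]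
  have hpi : √(2 * Real.pi) * √(2 * Real.pi) = 2 * Real.pi :=
    Real.mul_self_sqrt (by positivity)
  calc ((k + j).choose k : ℝ) * (k : ℝ) ^ k * (j : ℝ) ^ j
      ≤ ((k + j).choose k : ℝ) * (k.factorial * Real.exp k / (√(2 * Real.pi) * √k)) *
          (j.factorial * Real.exp j / (√(2 * Real.pi) * √j)) := by gcongr
    _ = ((k + j).factorial * Real.exp ((k + j : ℕ) : ℝ)) / (2 * Real.pi * (√k * √j)) := by
        rw [← e4, Nat.cast_add k j, Real.exp_add]
        generalize √(2 * Real.pi) = p at hpi ⊢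
        rw [← hpi]
        field_simp
    _ ≤ (Real.exp 1 * √((k + j : ℕ) : ℝ) * ((k + j : ℕ) : ℝ) ^ (k + j)) /
          (2 * Real.pi * (√k * √j)) := by gcongr
    _ ≤ (Real.exp 1 * (√(k : ℝ) + √(j : ℝ)) * ((k + j : ℕ) : ℝ) ^ (k + j)) /
          (2 * Real.pi * (√k * √j)) := by gcongr
    _ = _ := by
        field_simp
        ring

theorem abelSum_le {n : ℕ} (hn : 1 ≤ n) :
    ∑ k ∈ range (n + 1), (n.choose k : ℝ) * (k : ℝ) ^ k * ((n - k : ℕ) : ℝ) ^ (n - k) ≤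
      2 * √(n : ℝ) * (n : ℝ) ^ n := by
  have hn0 : (0 : ℝ) ≤ n := by positivity
  rcases lt_or_ge n 60 with h | h
  · have h1 := abelSum_sq_le_of_lt_sixty h hn
    refine le_of_sq_le_sq ?_ (by positivity)
    rw [mul_pow, mul_pow, Real.sq_sqrt hn0]
    norm_num
    exact_mod_cast h1
  · rw [sum_range_succ, range_eq_Ico, sum_eq_sum_Ico_succ_bot (by omega)]
    have hmid : ∑ k ∈ Ico (0 + 1) n,
        (n.choose k : ℝ) * (k : ℝ) ^ k * ((n - k : ℕ) : ℝ) ^ (n - k) ≤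
        Real.exp 1 / (2 * Real.pi) * (4 * √(n : ℝ)) * (n : ℝ) ^ n := by
      calc _ ≤ ∑ k ∈ Ico 1 n, Real.exp 1 / (2 * Real.pi) *
            ((√(k : ℝ))⁻¹ + (√((n - k : ℕ) : ℝ))⁻¹) * (n : ℝ) ^ n := by
            refine sum_le_sum fun k hk => ?_
            rw [mem_Ico] at hk
            exact choose_mul_pow_self_le (by omega) hk.2
        _ = Real.exp 1 / (2 * Real.pi) * (2 * ∑ k ∈ Ico 1 n, (√(k : ℝ))⁻¹) * (n : ℝ) ^ n := by
            rw [← sum_mul, ← mul_sum, sum_add_distrib,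
              sum_Ico_reflect (fun k => (√(k : ℝ))⁻¹) 1 (show n ≤ n + 1 by omega)]
            simp [two_mul]
        _ ≤ _ := by
            have : 2 * ∑ k ∈ Ico 1 n, (√(k : ℝ))⁻¹ ≤ 4 * √(n : ℝ) := by
              linarith [sum_Ico_inv_sqrt_le n]
            exact mul_le_mul_of_nonneg_right
              (mul_le_mul_of_nonneg_left this (by positivity)) (by positivity)
    have hs : (7.7 : ℝ) ≤ √(n : ℝ) := by
      refine Real.le_sqrt_of_sq_le ?_
      have : (60 : ℝ) ≤ n := by exact_mod_cast h
      norm_num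
      linarith
    have hc : Real.exp 1 / (2 * Real.pi) ≤ 0.4329 := by
      rw [div_le_iff₀ (by positivity)]
      have := Real.exp_one_lt_d9
      have := Real.pi_gt_d4
      norm_num at *
      linarith
    have hmul : Real.exp 1 / (2 * Real.pi) * (4 * √(n : ℝ)) ≤ 0.4329 * (4 * √(n : ℝ)) := by
      gcongr
    have hp : (0 : ℝ) ≤ (n : ℝ) ^ n := by positivity
    have : (2 + 0.4329 * (4 * √(n : ℝ))) * (n : ℝ) ^ n ≤ 2 * √(n : ℝ) * (n : ℝ) ^ n := by
      refine mul_le_mul_of_nonneg_right ?_ hp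
      norm_num at *
      linarith
    have h5 := mul_le_mul_of_nonneg_right hmul hp
    simp only [Nat.choose_zero_right, Nat.cast_one, pow_zero, Nat.sub_zero, one_mul,
      Nat.choose_self, Nat.sub_self, mul_one]
    linarith

theorem sum_choose_mul_div_pow_le {n m : ℕ} (hnm : n ≤ m) (hm : 0 < m) :
    ∑ k ∈ range (n + 1), (n.choose k : ℝ) *
      (((k : ℝ) / n) ^ k * (((n - k : ℕ) : ℝ) / n) ^ (n - k)) ≤ 2 * √(m : ℝ) := by
  have hm' : (1 : ℝ) ≤ √(m : ℝ) := Real.one_le_sqrt.2 (by exact_mod_cast hm)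
  rcases Nat.eq_zero_or_pos n with rfl | hn
  · simp
    linarith
  have hn' : (0 : ℝ) < n := by exact_mod_cast hn
  calc _ = (∑ k ∈ range (n + 1),
        (n.choose k : ℝ) * (k : ℝ) ^ k * ((n - k : ℕ) : ℝ) ^ (n - k)) / (n : ℝ) ^ n := by
        rw [sum_div]
        refine sum_congr rfl fun k hk => ?_
        have : n = k + (n - k) := by rw [mem_range] at hk; omega
        have h2 : (n : ℝ) ^ n = (n : ℝ) ^ k * (n : ℝ) ^ (n - k) := by rw [← pow_add, ← this]
        rw [h2, div_pow, div_pow]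
        field_simp
    _ ≤ 2 * √(n : ℝ) := by
        rw [div_le_iff₀ (by positivity)]
        exact abelSum_le hn
    _ ≤ _ := by gcongr

end AbelSum

/-- The ratio of the likelihoods of `k` successes in `n` trials under the empirical parameter
`k / n` and under success and failure probabilities `p` and `p'`. -/
noncomputable def likelihoodRatio (k n : ℕ) (p p' : ℝ≥0∞) : ℝ≥0∞ :=
  (ENNReal.ofReal ((k : ℝ) / n) / p) ^ k *
    (ENNReal.ofReal (((n - k : ℕ) : ℝ) / n) / p') ^ (n - k)

section Deterministic

theorem ofReal_exp_le_div_pow {k n : ℕ} (hn : 0 < n) {r p : ℝ} (hr : 0 ≤ r) (hp : 0 ≤ p)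
    (hrk : r = 0 → k = 0) :
    ENNReal.ofReal (Real.exp (k * Real.log r + k - n * r * p)) ≤
      (ENNReal.ofReal ((k : ℝ) / n) / ENNReal.ofReal p) ^ k := by
  have hn' : (0 : ℝ) < n := by exact_mod_cast hn
  rcases Nat.eq_zero_or_pos k with rfl | hk
  · simp only [pow_zero, ENNReal.ofReal_le_one, Real.exp_le_one_iff]
    have : 0 ≤ n * r * p := by positivity
    simp
    linarith
  have hk' : (0 : ℝ) < k := by exact_mod_cast hk
  have hr' : 0 < r := lt_of_le_of_ne hr fun h0 => hk.ne' (hrk h0.symm)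
  rcases hp.eq_or_lt with rfl | hp
  · have hne : ENNReal.ofReal ((k : ℝ) / n) ≠ 0 := by
      simp only [ne_eq, ENNReal.ofReal_eq_zero, not_le]
      positivity
    rw [ENNReal.ofReal_zero, ENNReal.div_zero hne, ENNReal.top_pow hk.ne']
    exact le_top
  rw [← ENNReal.ofReal_div_of_pos hp, ← ENNReal.ofReal_pow (by positivity)]
  refine ENNReal.ofReal_le_ofReal ?_
  have hu : 0 < r * (p * n / k) := by positivity
  have h1 : r * (p * n / k) ≤ Real.exp (r * (p * n / k) - 1) := by
    have := Real.add_one_le_exp (r * (p * n / k) - 1)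
    linarith
  have h2 : r * Real.exp (1 - r * (p * n / k)) ≤ (k : ℝ) / n / p := by
    rw [← neg_sub, Real.exp_neg, ← div_eq_mul_inv, div_le_iff₀ (Real.exp_pos _)]
    calc r = (k : ℝ) / n / p * (r * (p * n / k)) := by field_simp
      _ ≤ _ := by gcongr
  calc Real.exp (k * Real.log r + k - n * r * p)
      = (r * Real.exp (1 - r * (p * n / k))) ^ k := by
        rw [mul_pow, ← Real.exp_nat_mul, ← Real.exp_log (pow_pos hr' k), ← Real.exp_add,
          Real.log_pow]
        congr 1
        field_simp
        ring
    _ ≤ _ := by gcongr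

variable {H : Type*} [MeasurableSpace H]

/-- A change of measure inequality in the style of Donsker and Varadhan. -/
theorem integral_le_integral_log_rnDeriv_add_log {P Q : Measure H} [IsProbabilityMeasure P]
    [IsProbabilityMeasure Q] (hQP : Q ≪ P)
    (hint : Integrable (fun x => Real.log (Q.rnDeriv P x).toReal) Q) {φ : H → ℝ}
    (hφ : Integrable φ Q) {G : H → ℝ≥0∞} (hG : Measurable G)
    (hφG : ∀ᵐ x ∂Q, ENNReal.ofReal (Real.exp (φ x)) ≤ G x) {c : ℝ} (hc : 0 < c)
    (hGc : ∫⁻ x, G x ∂P ≤ ENNReal.ofReal c) :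
    ∫ x, φ x ∂Q ≤ ∫ x, Real.log (Q.rnDeriv P x).toReal ∂Q + Real.log c := by
  set ρ := Q.rnDeriv P with hρ
  have hρm : Measurable ρ := Measure.measurable_rnDeriv Q P
  have hpos : ∀ᵐ x ∂Q, 0 < ρ x := Measure.rnDeriv_pos hQP
  have hfin : ∀ᵐ x ∂Q, ρ x < ∞ := hQP.ae_le (Measure.rnDeriv_lt_top Q P)
  set g : H → ℝ := fun x => Real.exp (φ x) / (ρ x).toReal with hg
  have hgm : AEStronglyMeasurable g Q :=
    ((Real.measurable_exp.comp_aemeasurable hφ.aemeasurable).div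
      hρm.ennreal_toReal.aemeasurable).aestronglyMeasurable
  have hg0 : ∀ x, 0 ≤ g x := fun x => by positivity
  have hgle : ∫⁻ x, ENNReal.ofReal (g x) ∂Q ≤ ENNReal.ofReal c := by
    calc ∫⁻ x, ENNReal.ofReal (g x) ∂Q ≤ ∫⁻ x, G x / ρ x ∂Q := by
          refine lintegral_mono_ae ?_
          filter_upwards [hpos, hfin, hφG] with x h1 h2 h3
          rw [hg, ENNReal.ofReal_div_of_pos (ENNReal.toReal_pos h1.ne' h2.ne),
            ENNReal.ofReal_toReal h2.ne]
          gcongr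
      _ = ∫⁻ x, ρ x * (G x / ρ x) ∂P :=
          (lintegral_rnDeriv_mul hQP (hG.div hρm).aemeasurable).symm
      _ ≤ ∫⁻ x, G x ∂P := lintegral_mono fun x => ENNReal.mul_div_le
      _ ≤ _ := hGc
  have hgi : Integrable g Q := by
    refine ⟨hgm, ?_⟩
    rw [hasFiniteIntegral_iff_ofReal (Filter.Eventually.of_forall hg0)]
    exact hgle.trans_lt ENNReal.ofReal_lt_top
  have hgc : ∫ x, g x ∂Q ≤ c := by
    rw [integral_eq_lintegral_of_nonneg_ae (Filter.Eventually.of_forall hg0) hgm]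
    exact ENNReal.toReal_le_of_le_ofReal hc.le hgle
  have hle : ∀ᵐ x ∂Q, φ x - Real.log (ρ x).toReal ≤ g x / c + (Real.log c - 1) := by
    filter_upwards [hpos, hfin] with x h1 h2
    have h3 : 0 < (ρ x).toReal := ENNReal.toReal_pos h1.ne' h2.ne
    have h4 : 0 < g x := by positivity
    have h5 := Real.log_le_sub_one_of_pos (div_pos h4 hc)
    rw [Real.log_div h4.ne' hc.ne', hg, Real.log_div (Real.exp_pos _).ne' h3.ne',
      Real.log_exp] at h5
    linarith
  have := integral_mono_ae (hφ.sub hint) ((hgi.div_const c).add (integrable_const _)) hle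
  simp only [Pi.sub_apply, Pi.add_apply] at this
  rw [integral_sub hφ hint, integral_add (hgi.div_const c) (integrable_const _),
    integral_div] at this
  simp only [integral_const, probReal_univ, one_smul] at this
  have h6 : (∫ x, g x ∂Q) / c ≤ 1 := (div_le_one hc).2 hgc
  linarith

theorem mul_klBin_integral_le {P Q : Measure H} [IsProbabilityMeasure P]
    [IsProbabilityMeasure Q] (hQP : Q ≪ P)
    (hint : Integrable (fun x => Real.log (Q.rnDeriv P x).toReal) Q) {n : ℕ} (hn : 0 < n)
    {k : H → ℕ} (hk : Measurable k) (hkn : ∀ x, k x ≤ n) {p : H → ℝ} (hp : Measurable p)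
    (hp0 : ∀ x, 0 ≤ p x) (hp1 : ∀ x, p x ≤ 1) (h0 : 0 < ∫ x, p x ∂Q) (h1 : ∫ x, p x ∂Q < 1)
    {c : ℝ} (hc : 0 < c)
    (hP : ∫⁻ x, likelihoodRatio (k x) n (ENNReal.ofReal (p x)) (ENNReal.ofReal (1 - p x)) ∂P ≤
      ENNReal.ofReal c) :
    n * klBin (∫ x, (k x : ℝ) / n ∂Q) (∫ x, p x ∂Q) ≤
      ∫ x, Real.log (Q.rnDeriv P x).toReal ∂Q + Real.log c := by
  have hn' : (0 : ℝ) < n := by exact_mod_cast hn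
  have hkm : Measurable fun x => (k x : ℝ) := measurable_from_nat.comp hk
  have hki : Integrable (fun x => (k x : ℝ)) Q :=
    Integrable.of_bound hkm.aestronglyMeasurable (n : ℝ) (Filter.Eventually.of_forall fun x => by
      simpa using hkn x)
  have hpi : Integrable p Q :=
    Integrable.of_bound hp.aestronglyMeasurable 1 (Filter.Eventually.of_forall fun x => by
      simpa [abs_of_nonneg (hp0 x)] using hp1 x)
  have hq0' : 0 ≤ ∫ x, (k x : ℝ) ∂Q := integral_nonneg fun x => by positivity
  have hq1' : ∫ x, (k x : ℝ) ∂Q ≤ n := by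
    have := integral_mono hki (integrable_const (n : ℝ)) fun x => by
      simpa using hkn x
    simpa using this
  set q := ∫ x, (k x : ℝ) / n ∂Q with hq
  have hqn : ∫ x, (k x : ℝ) ∂Q = n * q := by
    rw [hq, integral_div]
    field_simp
  have hq0 : 0 ≤ q := integral_nonneg fun x => by positivity
  have hq1 : q ≤ 1 := by
    rw [hqn] at hq1'
    exact le_of_mul_le_mul_left (by simpa using hq1') hn'
  set v := ∫ x, p x ∂Q with hv
  have hv1 : 0 < 1 - v := by linarith
  set r := q / v with hr
  set s := (1 - q) / (1 - v) with hs
  have hcast : ∀ x, ((n - k x : ℕ) : ℝ) = n - k x := fun x => Nat.cast_sub (hkn x)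
  have hrk : ∀ᵐ x ∂Q, r = 0 → k x = 0 := by
    by_cases hr0 : r = 0
    · have : ∫ x, (k x : ℝ) ∂Q = 0 := by
        rw [hqn, mul_eq_zero]
        right
        simpa [hr, h0.ne'] using hr0
      rw [integral_eq_zero_iff_of_nonneg (fun x => by positivity) hki] at this
      filter_upwards [this] with x hx _
      simpa using hx
    · exact Filter.Eventually.of_forall fun x hx => absurd hx hr0
  have hki2 : Integrable (fun x => (n : ℝ) - k x) Q := (integrable_const _).sub hki
  have hsk : ∀ᵐ x ∂Q, s = 0 → n - k x = 0 := by
    by_cases hs0 : s = 0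
    · have : ∫ x, ((n : ℝ) - k x) ∂Q = 0 := by
        rw [integral_sub (integrable_const _) hki, hqn]
        have : 1 - q = 0 := by simpa [hs, hv1.ne'] using hs0
        simp
        linear_combination (n : ℝ) * this
      rw [integral_eq_zero_iff_of_nonneg (fun x => by
        simpa using hkn x) hki2] at this
      filter_upwards [this] with x hx _
      have hx' : (n : ℝ) - k x = 0 := hx
      rw [← hcast] at hx'
      exact_mod_cast hx'
    · exact Filter.Eventually.of_forall fun x hx => absurd hx hs0
  set φ : H → ℝ := fun x => (k x * Real.log r + k x - n * r * p x) +
    ((n - k x) * Real.log s + (n - k x) - n * s * (1 - p x)) with hφ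
  have i1 : Integrable (fun x => k x * Real.log r + k x - n * r * p x) Q :=
    ((hki.mul_const _).add hki).sub (hpi.const_mul _)
  have hpi2 : Integrable (fun x => 1 - p x) Q := (integrable_const _).sub hpi
  have i2 : Integrable (fun x => ((n : ℝ) - k x) * Real.log s + (n - k x) - n * s * (1 - p x)) Q :=
    ((hki2.mul_const _).add hki2).sub (hpi2.const_mul _)
  have hφint : ∫ x, φ x ∂Q = n * klBin q v := by
    rw [hφ, integral_add i1 i2, integral_sub (by fun_prop) (by fun_prop),
      integral_sub (by fun_prop) (by fun_prop), integral_add (by fun_prop) (by fun_prop),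
      integral_add (by fun_prop) (by fun_prop), integral_mul_const, integral_mul_const,
      integral_const_mul, integral_const_mul, integral_sub (by fun_prop) (by fun_prop),
      integral_sub (by fun_prop) (by fun_prop), hqn, ← hv]
    simp only [integral_const, probReal_univ, one_smul, klBin]
    have e1 : r * v = q := div_mul_cancel₀ _ h0.ne'
    have e2 : s * (1 - v) = 1 - q := div_mul_cancel₀ _ hv1.ne'
    linear_combination (-(n : ℝ)) * e1 - n * e2
  rw [← hφint]
  refine integral_le_integral_log_rnDeriv_add_log (φ := φ) hQP hint (i1.add i2) ?_ ?_ hc hP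
  · unfold likelihoodRatio
    fun_prop
  · filter_upwards [hrk, hsk] with x hx1 hx2
    have t1 := ofReal_exp_le_div_pow hn (r := r) (by positivity) (hp0 x) hx1
    have t2 := ofReal_exp_le_div_pow hn (r := s) (div_nonneg (by linarith) hv1.le)
      (show 0 ≤ 1 - p x by linarith [hp1 x]) hx2
    rw [hcast] at t2
    rw [hφ, Real.exp_add, ENNReal.ofReal_mul (Real.exp_pos _).le, likelihoodRatio, hcast]
    exact mul_le_mul' t1 t2

end Deterministic

section Expectation

open Finset

variable {Z : Type*} [MeasurableSpace Z]

theorem lintegral_pi_card_filter (D : Measure Z) [IsProbabilityMeasure D] {m : ℕ} {E F : Set Z}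
    (hE : MeasurableSet E) (hF : MeasurableSet F) (f : ℕ → ℕ → ℝ≥0∞) :
    ∫⁻ S, f #{j | S j ∈ E ∩ F} #{j | S j ∈ E} ∂Measure.pi (fun _ : Fin m => D) =
      ∑ A : Finset (Fin m), ∑ B ∈ A.powerset,
        D (E ∩ F) ^ #B * D (E ∩ Fᶜ) ^ (#A - #B) * D Eᶜ ^ (m - #A) * f #B #A := by
  set cell : Finset (Fin m) → Finset (Fin m) → Fin m → Set Z := fun A B j =>
    if j ∈ B then E ∩ F else if j ∈ A then E ∩ Fᶜ else Eᶜ with hcell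
  have hcm : ∀ A B, MeasurableSet (Set.pi Set.univ (cell A B)) := fun A B =>
    MeasurableSet.univ_pi fun j => by
      simp only [hcell]
      split_ifs
      exacts [hE.inter hF, hE.inter hF.compl, hE.compl]
  have hmem : ∀ A B, B ⊆ A → ∀ S : Fin m → Z, S ∈ Set.pi Set.univ (cell A B) ↔
      A = univ.filter (S · ∈ E) ∧ B = univ.filter (S · ∈ E ∩ F) := by
    intro A B hBA S
    simp only [Set.mem_pi, Set.mem_univ, true_implies, Finset.ext_iff, mem_filter, mem_univ,
      true_and, ← forall_and]
    refine forall_congr' fun j => ?_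
    have := @hBA j
    by_cases h1 : j ∈ B <;> by_cases h2 : j ∈ A <;> by_cases h3 : S j ∈ E <;>
      by_cases h4 : S j ∈ F <;> simp_all
  have hmeasure : ∀ A B, B ⊆ A → Measure.pi (fun _ : Fin m => D) (Set.pi Set.univ (cell A B)) =
      D (E ∩ F) ^ #B * D (E ∩ Fᶜ) ^ (#A - #B) * D Eᶜ ^ (m - #A) := by
    intro A B hBA
    rw [Measure.pi_pi]
    have : ∀ j, D (cell A B j) =
        if j ∈ B then D (E ∩ F) else if j ∈ A then D (E ∩ Fᶜ) else D Eᶜ := fun j => by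
      simp only [hcell]
      split_ifs <;> rfl
    simp only [this]
    rw [prod_ite, prod_const, prod_ite, prod_const, prod_const, ← mul_assoc]
    congr 3
    · simp
    · rw [← card_sdiff_of_subset hBA]
      congr 1
      ext j
      simp [and_comm]
    · have hA := card_compl A
      rw [Fintype.card_fin] at hA
      rw [← hA]
      congr 1
      ext j
      have := @hBA j
      simp
      tauto
  calc _ = ∫⁻ S, ∑ A : Finset (Fin m), ∑ B ∈ A.powerset,
        (Set.pi Set.univ (cell A B)).indicator (fun _ => f #B #A) S
          ∂Measure.pi (fun _ : Fin m => D) := by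
        refine lintegral_congr fun S => ?_
        have hsub : univ.filter (S · ∈ E ∩ F) ⊆ univ.filter (S · ∈ E) :=
          monotone_filter_right _ fun j _ hj => hj.1
        rw [sum_eq_single (univ.filter (S · ∈ E)),
          sum_eq_single (univ.filter (S · ∈ E ∩ F)), Set.indicator_of_mem]
        · exact (hmem _ _ hsub S).2 ⟨rfl, rfl⟩
        · intro B hB hne
          refine Set.indicator_of_notMem (fun hS => hne ?_) _
          exact ((hmem _ _ (mem_powerset.1 hB) S).1 hS).2
        · exact fun hn => absurd (mem_powerset.2 hsub) hn
        · intro A _ hne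
          refine sum_eq_zero fun B hB => Set.indicator_of_notMem (fun hS => hne ?_) _
          exact ((hmem _ _ (mem_powerset.1 hB) S).1 hS).1
        · exact fun hn => absurd (mem_univ _) hn
    _ = _ := by
        rw [lintegral_finsetSum _ fun A _ => Finset.measurable_sum _ fun B _ =>
          measurable_const.indicator (hcm A B)]
        refine sum_congr rfl fun A _ => ?_
        rw [lintegral_finsetSum _ fun B _ => measurable_const.indicator (hcm A B)]
        refine sum_congr rfl fun B hB => ?_
        rw [lintegral_indicator_const (hcm A B), hmeasure A B (mem_powerset.1 hB), mul_comm]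

theorem ENNReal.mul_div_inv_mul_le {a e : ℝ≥0∞} (q : ℝ≥0∞) (hae : a ≤ e) (he : e ≠ ∞) :
    a * (q / (e⁻¹ * a)) ≤ e * q := by
  rcases eq_or_ne a 0 with rfl | ha
  · simp
  have ha' : a ≠ ∞ := ne_top_of_le_ne_top he hae
  rw [div_eq_mul_inv, ENNReal.mul_inv (.inr ha') (.inr ha), inv_inv]
  calc a * (q * (e * a⁻¹)) = a * a⁻¹ * (e * q) := by ring
    _ = e * q := by rw [ENNReal.mul_inv_cancel ha ha', one_mul]
    _ ≤ _ := le_rfl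

theorem lintegral_pi_likelihoodRatio_le (D : Measure Z) [IsProbabilityMeasure D] {m : ℕ}
    (hm : 0 < m) {E F : Set Z} (hE : MeasurableSet E) (hF : MeasurableSet F) :
    ∫⁻ S, likelihoodRatio #{j | S j ∈ E ∩ F} #{j | S j ∈ E} (D[|E] F) (D[|E] Fᶜ)
      ∂Measure.pi (fun _ : Fin m => D) ≤ ENNReal.ofReal (2 * √(m : ℝ)) := by
  rw [lintegral_pi_card_filter D hE hF fun k n => likelihoodRatio k n (D[|E] F) (D[|E] Fᶜ),
    cond_apply hE, cond_apply hE]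
  have hterm : ∀ k n, k ≤ n → D (E ∩ F) ^ k * D (E ∩ Fᶜ) ^ (n - k) *
      likelihoodRatio k n ((D E)⁻¹ * D (E ∩ F)) ((D E)⁻¹ * D (E ∩ Fᶜ)) ≤
      D E ^ n * ENNReal.ofReal (((k : ℝ) / n) ^ k * (((n - k : ℕ) : ℝ) / n) ^ (n - k)) := by
    intro k n hkn
    rw [likelihoodRatio, mul_mul_mul_comm, ← mul_pow, ← mul_pow,
      ENNReal.ofReal_mul (by positivity), ENNReal.ofReal_pow (by positivity),
      ENNReal.ofReal_pow (by positivity)]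
    calc _ ≤ (D E * ENNReal.ofReal ((k : ℝ) / n)) ^ k *
          (D E * ENNReal.ofReal (((n - k : ℕ) : ℝ) / n)) ^ (n - k) := by
          have hle : ∀ (s : Set Z) (q : ℝ≥0∞),
              D (E ∩ s) * (q / ((D E)⁻¹ * D (E ∩ s))) ≤ D E * q := fun s q =>
            ENNReal.mul_div_inv_mul_le q (measure_mono Set.inter_subset_left) (measure_ne_top _ _)
          exact mul_le_mul' (pow_le_pow_left' (hle F _) k) (pow_le_pow_left' (hle Fᶜ _) (n - k))
      _ = _ := by
          rw [mul_pow, mul_pow, mul_mul_mul_comm, ← pow_add, Nat.add_sub_cancel' hkn]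
  have hinner : ∀ n ≤ m, ∑ k ∈ range (n + 1), (n.choose k : ℝ≥0∞) *
      ENNReal.ofReal (((k : ℝ) / n) ^ k * (((n - k : ℕ) : ℝ) / n) ^ (n - k)) ≤
      ENNReal.ofReal (2 * √(m : ℝ)) := by
    intro n hn
    rw [← sum_congr rfl fun k _ => by
      rw [← ENNReal.ofReal_natCast, ← ENNReal.ofReal_mul (by positivity)],
      ← ENNReal.ofReal_sum_of_nonneg fun k _ => by positivity]
    exact ENNReal.ofReal_le_ofReal (sum_choose_mul_div_pow_le hn hm)
  calc _ ≤ ∑ A : Finset (Fin m), D E ^ #A * D Eᶜ ^ (m - #A) * ENNReal.ofReal (2 * √(m : ℝ)) := by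
        refine sum_le_sum fun A _ => ?_
        calc _ ≤ ∑ B ∈ A.powerset, D E ^ #A * D Eᶜ ^ (m - #A) * ENNReal.ofReal
              (((#B : ℝ) / #A) ^ #B * (((#A - #B : ℕ) : ℝ) / #A) ^ (#A - #B)) := by
              refine sum_le_sum fun B hB => ?_
              have := hterm #B #A (card_le_card (mem_powerset.1 hB))
              rw [mul_right_comm, mul_right_comm (D E ^ #A)]
              gcongr
          _ = D E ^ #A * D Eᶜ ^ (m - #A) * ∑ k ∈ range (#A + 1), ((#A).choose k : ℝ≥0∞) *
              ENNReal.ofReal (((k : ℝ) / #A) ^ k * (((#A - k : ℕ) : ℝ) / #A) ^ (#A - k)) := by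
              rw [← mul_sum, sum_powerset_apply_card fun k => ENNReal.ofReal
                (((k : ℝ) / #A) ^ k * (((#A - k : ℕ) : ℝ) / #A) ^ (#A - k))]
              simp
          _ ≤ _ := by
              gcongr
              exact hinner _ (by simpa using card_le_univ A)
    _ = ENNReal.ofReal (2 * √(m : ℝ)) := by
        rw [← sum_mul, Fin.sum_pow_mul_eq_add_pow, measure_add_measure_compl hE, measure_univ,
          one_pow, one_mul]

end Expectation

section Probability

theorem one_sub_ofReal_le_measure_setOf_le {Ω : Type*} [MeasurableSpace Ω] {μ : Measure Ω}
    [IsProbabilityMeasure μ] {Φ : Ω → ℝ≥0∞} (hΦ : Measurable Φ) {a δ : ℝ} (ha : 0 < a)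
    (hδ : 0 < δ) (hint : ∫⁻ x, Φ x ∂μ ≤ ENNReal.ofReal a) :
    1 - ENNReal.ofReal δ ≤ μ {x | Φ x ≤ ENNReal.ofReal (a / δ)} := by
  set c := ENNReal.ofReal (a / δ) with hc
  have hc0 : c ≠ 0 := by simpa [hc] using div_pos ha hδ
  have hbad : μ {x | c ≤ Φ x} ≤ ENNReal.ofReal δ := by
    have h1 : c * μ {x | c ≤ Φ x} ≤ c * ENNReal.ofReal δ := by
      refine (mul_meas_ge_le_lintegral hΦ c).trans (hint.trans_eq ?_)
      rw [hc, ← ENNReal.ofReal_mul (by positivity), div_mul_cancel₀ _ hδ.ne']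
    exact (ENNReal.mul_le_mul_iff_right hc0 ENNReal.ofReal_ne_top).1 h1
  have hcompl : {x | Φ x ≤ c}ᶜ ⊆ {x | c ≤ Φ x} := fun x hx =>
    (not_le.1 (show ¬Φ x ≤ c from hx)).le
  rw [tsub_le_iff_right]
  calc (1 : ℝ≥0∞) = μ {x | Φ x ≤ c} + μ {x | Φ x ≤ c}ᶜ := by
        rw [measure_add_measure_compl (measurableSet_le hΦ measurable_const), measure_univ]
    _ ≤ _ := by gcongr; exact (measure_mono hcompl).trans hbad

variable {Z H : Type*} [MeasurableSpace Z] [MeasurableSpace H]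

theorem measurable_card_filter {m : ℕ} {α : Type*} [MeasurableSpace α] {p : α → Fin m → Prop}
    [∀ x, DecidablePred (p x)] (hp : ∀ j, MeasurableSet {x | p x j}) :
    Measurable fun x => (Finset.univ.filter (p x)).card := by
  simp only [Finset.card_filter]
  exact Finset.measurable_sum _ fun j _ => Measurable.ite (hp j) measurable_const measurable_const

theorem measurable_likelihoodRatio {α : Type*} [MeasurableSpace α] {k n : α → ℕ} {p p' : α → ℝ≥0∞}
    (hk : Measurable k) (hn : Measurable n) (hp : Measurable p) (hp' : Measurable p') :
    Measurable fun x => likelihoodRatio (k x) (n x) (p x) (p' x) := by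
  have hkr : Measurable fun x => (k x : ℝ) := measurable_from_nat.comp hk
  have hnr : Measurable fun x => (n x : ℝ) := measurable_from_nat.comp hn
  have hnk : Measurable fun x => n x - k x := hn.sub hk
  have hnkr : Measurable fun x => ((n x - k x : ℕ) : ℝ) := measurable_from_nat.comp hnk
  unfold likelihoodRatio
  exact (((hkr.div hnr).ennreal_ofReal.div hp).pow hk).mul
    (((hnkr.div hnr).ennreal_ofReal.div hp').pow hnk)

theorem klBin_zero_right_nonpos {q : ℝ} (h0 : 0 ≤ q) (h1 : q ≤ 1) : klBin q 0 ≤ 0 := by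
  simp only [klBin, div_zero, Real.log_zero, mul_zero, sub_zero, div_one, zero_add]
  exact mul_nonpos_of_nonneg_of_nonpos (by linarith) (Real.log_nonpos (by linarith) (by linarith))

theorem klBin_one_right_nonpos {q : ℝ} (h0 : 0 ≤ q) (h1 : q ≤ 1) : klBin q 1 ≤ 0 := by
  simp only [klBin, div_one, sub_self, div_zero, Real.log_zero, mul_zero, add_zero]
  exact mul_nonpos_of_nonneg_of_nonpos h0 (Real.log_nonpos h0 h1)

theorem ofReal_klBin_le_of_lintegral_likelihoodRatio_le {P Q : Measure H} [IsProbabilityMeasure P]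
    [IsProbabilityMeasure Q] {n : ℕ} {k : H → ℕ} (hk : Measurable k) (hkn : ∀ x, k x ≤ n)
    (μ : Measure Z) [IsZeroOrProbabilityMeasure μ] {F : Set (H × Z)} (hF : MeasurableSet F)
    {c : ℝ} (hc : 1 < c)
    (hP : ∫⁻ x, likelihoodRatio (k x) n (μ (Prod.mk x ⁻¹' F)) (μ (Prod.mk x ⁻¹' F)ᶜ) ∂P ≤
      ENNReal.ofReal c) :
    ENNReal.ofReal (klBin (∫ x, (k x : ℝ) / n ∂Q) (∫ x, μ.real (Prod.mk x ⁻¹' F) ∂Q)) ≤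
      (n : ℝ≥0∞)⁻¹ * (klDivM Q P + ENNReal.ofReal (Real.log c)) := by
  have hlog : 0 < Real.log c := Real.log_pos hc
  rcases Nat.eq_zero_or_pos n with rfl | hn
  · rw [show ((0 : ℕ) : ℝ≥0∞)⁻¹ = ∞ by simp, ENNReal.top_mul]
    · exact le_top
    · simp [hlog]
  have hn' : (0 : ℝ) < n := by exact_mod_cast hn
  have hkle : ∀ x, (k x : ℝ) / n ≤ 1 := fun x => by
    rw [div_le_one hn']
    exact_mod_cast hkn x
  have hkm : Measurable fun x => (k x : ℝ) / n := (measurable_from_nat.comp hk).div_const _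
  have hq0 : 0 ≤ ∫ x, (k x : ℝ) / n ∂Q := integral_nonneg fun x => by positivity
  have hq1 : ∫ x, (k x : ℝ) / n ∂Q ≤ 1 := by
    have := integral_mono (μ := Q) (Integrable.of_bound hkm.aestronglyMeasurable 1
      (Filter.Eventually.of_forall fun x => by
        rw [Real.norm_of_nonneg (by positivity)]
        exact hkle x)) (integrable_const (1 : ℝ)) hkle
    simpa using this
  have hp0 : ∀ x, 0 ≤ μ.real (Prod.mk x ⁻¹' F) := fun x => measureReal_nonneg
  have hp1 : ∀ x, μ.real (Prod.mk x ⁻¹' F) ≤ 1 := fun x => measureReal_le_one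
  have hpm : Measurable fun x => μ.real (Prod.mk x ⁻¹' F) :=
    (measurable_measure_prodMk_left hF).ennreal_toReal
  have hv0 : 0 ≤ ∫ x, μ.real (Prod.mk x ⁻¹' F) ∂Q := integral_nonneg hp0
  have hv1 : ∫ x, μ.real (Prod.mk x ⁻¹' F) ∂Q ≤ 1 := by
    have := integral_mono (μ := Q) (Integrable.of_bound hpm.aestronglyMeasurable 1
      (Filter.Eventually.of_forall fun x => by
        rw [Real.norm_of_nonneg (hp0 x)]
        exact hp1 x)) (integrable_const (1 : ℝ)) hp1
    simpa using this
  rcases hv0.eq_or_lt with hv | hv0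
  · rw [← hv, ENNReal.ofReal_of_nonpos (klBin_zero_right_nonpos hq0 hq1)]
    exact zero_le
  rcases hv1.eq_or_lt with hv | hv1
  · rw [hv, ENNReal.ofReal_of_nonpos (klBin_one_right_nonpos hq0 hq1)]
    exact zero_le
  unfold klDivM
  split_ifs with hQP
  swap
  · rw [top_add, ENNReal.mul_top (ENNReal.inv_ne_zero.2 (ENNReal.natCast_ne_top n))]
    exact le_top
  have hμ : IsProbabilityMeasure μ := by
    rcases eq_zero_or_isProbabilityMeasure μ with rfl | hμ
    · simp at hv0
    · exact hμ
  have key := mul_klBin_integral_le hQP.1 hQP.2 hn hk hkn hpm hp0 hp1 hv0 hv1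
    (zero_lt_one.trans hc) (by
      refine (lintegral_congr fun x => ?_).trans_le hP
      rw [ofReal_measureReal, ← probReal_compl_eq_one_sub (measurable_prodMk_left hF),
        ofReal_measureReal])
  rw [mul_comm, ← le_div_iff₀ hn'] at key
  rw [mul_comm, ← div_eq_mul_inv, ENNReal.le_div_iff_mul_le (by simp [hn.ne']) (by simp),
    ← ENNReal.ofReal_natCast, ← ENNReal.ofReal_mul' hn'.le]
  rw [le_div_iff₀ hn'] at key
  exact (ENNReal.ofReal_le_ofReal key).trans ENNReal.ofReal_add_le

/-- The conditional PAC-Bayes bound with the losses replaced by their level sets: `E` is the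
conditioning event and the section of `F` at `x` is the error event of `x`. -/
theorem one_sub_le_measure_forall_klBin_le (D : Measure Z) [IsProbabilityMeasure D]
    (P : Measure H) [IsProbabilityMeasure P] {E : Set Z} (hE : MeasurableSet E)
    {F : Set (H × Z)} (hF : MeasurableSet F) {m : ℕ} (hm : 0 < m) {δ : ℝ} (hδ : 0 < δ)
    (hδ1 : δ ≤ 1) :
    1 - ENNReal.ofReal δ ≤ Measure.pi (fun _ : Fin m => D)
      {S | ∀ Q : Measure H, IsProbabilityMeasure Q →
        ENNReal.ofReal (klBin
          (∫ x, ((Finset.univ.filter fun j => S j ∈ E ∩ Prod.mk x ⁻¹' F).card : ℝ) /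
            (Finset.univ.filter fun j => S j ∈ E).card ∂Q)
          (∫ x, (D[|E]).real (Prod.mk x ⁻¹' F) ∂Q)) ≤
        ((Finset.univ.filter fun j => S j ∈ E).card : ℝ≥0∞)⁻¹ *
          (klDivM Q P + ENNReal.ofReal (Real.log (2 * √(m : ℝ) / δ)))} := by
  have hFx : ∀ x, MeasurableSet (Prod.mk x ⁻¹' F) := fun x => measurable_prodMk_left hF
  have hsqrt : (1 : ℝ) ≤ √(m : ℝ) := Real.one_le_sqrt.2 (by exact_mod_cast hm)
  have hc : 1 < 2 * √(m : ℝ) / δ := by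
    rw [lt_div_iff₀ hδ]
    linarith
  set k : (Fin m → Z) → H → ℕ := fun S x =>
    (Finset.univ.filter fun j : Fin m => S j ∈ E ∩ Prod.mk x ⁻¹' F).card with hk
  set n : (Fin m → Z) → ℕ := fun S =>
    (Finset.univ.filter fun j : Fin m => S j ∈ E).card with hn
  have hkm : Measurable fun q : (Fin m → Z) × H => k q.1 q.2 :=
    measurable_card_filter (p := fun (q : (Fin m → Z) × H) j => q.1 j ∈ E ∩ Prod.mk q.2 ⁻¹' F) fun j => by
      have h1 : Measurable fun q : (Fin m → Z) × H => q.1 j := by fun_prop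
      exact (h1 hE).inter ((measurable_snd.prodMk h1) hF)
  have hnm : Measurable n :=
    measurable_card_filter (p := fun (S : Fin m → Z) j => S j ∈ E) fun j => measurable_pi_apply j hE
  have hpm : Measurable fun x => D[|E] (Prod.mk x ⁻¹' F) := measurable_measure_prodMk_left hF
  have hpm' : Measurable fun x => D[|E] (Prod.mk x ⁻¹' F)ᶜ :=
    measurable_measure_prodMk_left hF.compl
  have hRm : Measurable fun q : (Fin m → Z) × H => likelihoodRatio (k q.1 q.2) (n q.1)
      (D[|E] (Prod.mk q.2 ⁻¹' F)) (D[|E] (Prod.mk q.2 ⁻¹' F)ᶜ) :=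
    measurable_likelihoodRatio (k := fun q : (Fin m → Z) × H => k q.1 q.2) hkm
      (hnm.comp measurable_fst) (hpm.comp measurable_snd) (hpm'.comp measurable_snd)
  have hint : ∫⁻ S, ∫⁻ x, likelihoodRatio (k S x) (n S)
      (D[|E] (Prod.mk x ⁻¹' F)) (D[|E] (Prod.mk x ⁻¹' F)ᶜ) ∂P ∂Measure.pi (fun _ : Fin m => D) ≤
      ENNReal.ofReal (2 * √(m : ℝ)) := by
    rw [lintegral_lintegral_swap hRm.aemeasurable]
    calc _ ≤ ∫⁻ _, ENNReal.ofReal (2 * √(m : ℝ)) ∂P :=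
          lintegral_mono fun x => lintegral_pi_likelihoodRatio_le D hm hE (hFx x)
      _ = _ := by simp
  have hΦm : Measurable fun S => ∫⁻ x, likelihoodRatio (k S x) (n S)
      (D[|E] (Prod.mk x ⁻¹' F)) (D[|E] (Prod.mk x ⁻¹' F)ᶜ) ∂P := hRm.lintegral_prod_right'
  have hgood := one_sub_ofReal_le_measure_setOf_le hΦm (by positivity) hδ hint
  refine hgood.trans (measure_mono ?_)
  intro S hS Q hQ
  have hkn : ∀ x, k S x ≤ n S := fun x =>
    Finset.card_le_card (Finset.monotone_filter_right _ fun j _ hj => hj.1)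
  exact ofReal_klBin_le_of_lintegral_likelihoodRatio_le (Q := Q)
    (hkm.comp measurable_prodMk_left) hkn (D[|E]) hF hc hS

end Probability

theorem conditional_pac_bayes_incorrect
    {X Y H : Type*} [MeasurableSpace X] [MeasurableSpace Y] [MeasurableSpace H]
    (D : Measure (X × Y)) [IsProbabilityMeasure D]
    (P : Measure H) [IsProbabilityMeasure P]
    (ℓ : H → X × Y → ℝ)
    (hbin : ∀ h' z, ℓ h' z = 0 ∨ ℓ h' z = 1)
    (hmeas : Measurable fun p : H × (X × Y) => ℓ p.1 p.2)
    (h : H) (m : ℕ) (hm : 0 < m)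
    (δ : ℝ) (hδ : 0 < δ) (hδ1 : δ ≤ 1) :
    1 - ENNReal.ofReal δ ≤
      Measure.pi (fun _ : Fin m => D)
        {S : Fin m → X × Y | ∀ Q : Measure H, IsProbabilityMeasure Q →
          ENNReal.ofReal
              (klBin
                -- ĉ_S^Q(h): Q-average empirical loss on S_{(h,1)} = {j | ℓ(h(x_j),y_j) = 1}
                (∫ h', (((Finset.univ.filter fun j : Fin m => ℓ h (S j) = 1).card : ℝ))⁻¹ *
                    ∑ j ∈ Finset.univ.filter fun j : Fin m => ℓ h (S j) = 1, ℓ h' (S j) ∂Q)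
                -- c_D^Q(h): Q-stochastic risk conditioned on h being incorrect
                (∫ z, (∫ h', ℓ h' z ∂Q) ∂(D[|{z | ℓ h z = 1}])))
            ≤ (((Finset.univ.filter fun j : Fin m => ℓ h (S j) = 1).card : ℝ≥0∞))⁻¹ *
                (klDivM Q P + ENNReal.ofReal (Real.log (2 * Real.sqrt m / δ)))} := by
  set E : Set (X × Y) := {z | ℓ h z = 1} with hEdef
  set F : Set (H × (X × Y)) := {p | ℓ p.1 p.2 = 1} with hFdef
  have hF : MeasurableSet F := hmeas (measurableSet_singleton 1)
  have hFx : ∀ x, MeasurableSet (Prod.mk x ⁻¹' F) := fun x => measurable_prodMk_left hF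
  have hE : MeasurableSet E := hFx h
  refine (one_sub_le_measure_forall_klBin_le D P hE hF hm hδ hδ1).trans
    (measure_mono fun S hS Q hQ => ?_)
  have key := hS Q hQ
  have hind : ∀ x z, ℓ x z = (Prod.mk x ⁻¹' F).indicator (fun _ => (1 : ℝ)) z := fun x z => by
    rcases hbin x z with h0 | h1
    · rw [h0, Set.indicator_of_notMem]
      simp [hFdef, h0]
    · rw [h1, Set.indicator_of_mem]
      exact h1
  have hcond : (Finset.univ.filter fun j : Fin m => ℓ h (S j) = 1) =
      Finset.univ.filter fun j => S j ∈ E := by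
    ext j
    simp [hEdef]
  have hemp : ∀ x, ((Finset.univ.filter fun j => S j ∈ E).card : ℝ)⁻¹ *
      ∑ j ∈ Finset.univ.filter (fun j => S j ∈ E), ℓ x (S j) =
      ((Finset.univ.filter fun j => S j ∈ E ∩ Prod.mk x ⁻¹' F).card : ℝ) /
        (Finset.univ.filter fun j => S j ∈ E).card := fun x => by
    have hcard : (Finset.univ.filter fun j => S j ∈ E ∩ Prod.mk x ⁻¹' F) =
        (Finset.univ.filter fun j => S j ∈ E).filter fun j => S j ∈ Prod.mk x ⁻¹' F := by
      ext j
      simp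
    have hsum : ∑ j ∈ Finset.univ.filter (fun j => S j ∈ E), ℓ x (S j) =
        ((Finset.univ.filter fun j => S j ∈ E ∩ Prod.mk x ⁻¹' F).card : ℝ) := by
      rw [hcard, Finset.card_filter, Nat.cast_sum]
      refine Finset.sum_congr rfl fun j _ => ?_
      rw [hind, Set.indicator_apply]
      split_ifs <;> simp
    rw [hsum, inv_mul_eq_div]
  have hrisk : ∫ z, (∫ x, ℓ x z ∂Q) ∂(D[|E]) = ∫ x, (D[|E]).real (Prod.mk x ⁻¹' F) ∂Q := by
    rw [integral_integral_swap]
    · refine integral_congr_ae (Filter.Eventually.of_forall fun x => ?_)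
      simp only [hind x]
      rw [integral_indicator_const _ (hFx x), smul_eq_mul, mul_one]
    · refine Integrable.of_bound (hmeas.comp measurable_swap).aestronglyMeasurable 1
        (Filter.Eventually.of_forall fun q => ?_)
      rcases hbin q.2 q.1 with h0 | h1
      · simp [Function.uncurry, h0]
      · simp [Function.uncurry, h1]
  rw [← hrisk, ← integral_congr_ae (Filter.Eventually.of_forall hemp)] at key
  rw [hcond]
  exact key
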